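/- arXiv:1704.04641 — 2 statements merged into one kernel-verified Lean document; each statement's English description precedes it below -/
import Mathlib

section
/- Define R₁₁ = (1/2)·log(1 + p₁₁/(2p₁₀ + 2p₃₀ + p₃₁ + σ)), R₃₁ = (1/2)·log(1 + p₃₁/(2p₁₀ + 2p₃₀ + σ)), R₁₀ = (1/2)·[log(1/2 + p₁₀/(2p₃₀ + σ))]⁺, and R₃₀ = (1/2)·[log(1/2 + p₃₀/σ)]⁺. Then R₁₀ + R₁₁ ≥ (C₁₃ − C₂₃ + C₂₄ − C₄) − 1/2, R₁₀ ≥ (C₂₄ − C₄) − 1/2, R₃₀ + R₃₁ ≥ (C₂₃ − C₂₄ + C₄) − 1/2, and R₃₀ ≥ C₄ − 1/2. -/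
theorem logb_two_one_add_div {x y : ℝ} (hx : 0 ≤ x) (hy : 0 < y) :
    Real.logb 2 (1 + x / y) = Real.logb 2 (y + x) - Real.logb 2 y := by
  rw [← Real.logb_div (by positivity) hy.ne', add_div, div_self hy.ne']

theorem logb_two_half_add_div {x y : ℝ} (hx : 0 ≤ x) (hy : 0 < y) :
    Real.logb 2 (1 / 2 + x / 2 / y) = Real.logb 2 (y + x) - Real.logb 2 y - 1 := by
  have h : 1 / 2 + x / 2 / y = (1 + x / y) / 2 := by ring
  rw [h, Real.logb_div (by positivity) two_ne_zero, logb_two_one_add_div hx hy,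
    Real.logb_self_eq_one one_lt_two]


theorem stmt6 (a1 a2 a3 a4 σ p10 p30 p11 p31 C1 C2 C3 C4 C13 C14 C23 C24 R10 R11 R30 R31 : ℝ)
    (ha1 : 0 < a1) (ha2 : 0 < a2) (ha3 : 0 < a3) (ha4 : 0 < a4) (hσ : 0 < σ)
    (h12 : a2 ≤ a1) (h34 : a4 ≤ a3)
    (hC1 : C1 = 1/2 * Real.logb 2 (1 + a1/σ))
    (hC2 : C2 = 1/2 * Real.logb 2 (1 + a2/σ))
    (hC3 : C3 = 1/2 * Real.logb 2 (1 + a3/σ))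
    (hC4 : C4 = 1/2 * Real.logb 2 (1 + a4/σ))
    (hC13 : C13 = 1/2 * Real.logb 2 (1 + (a1 + a3)/σ))
    (hC14 : C14 = 1/2 * Real.logb 2 (1 + (a1 + a4)/σ))
    (hC23 : C23 = 1/2 * Real.logb 2 (1 + (a2 + a3)/σ))
    (hC24 : C24 = 1/2 * Real.logb 2 (1 + (a2 + a4)/σ))
    (hp10 : p10 = a2/2) (hp30 : p30 = a4/2)
    (hp11 : p11 = a1 - a2) (hp31 : p31 = a3 - a4)
    (hR11 : R11 = 1/2 * Real.logb 2 (1 + p11/(2*p10 + 2*p30 + p31 + σ)))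
    (hR31 : R31 = 1/2 * Real.logb 2 (1 + p31/(2*p10 + 2*p30 + σ)))
    (hR10 : R10 = 1/2 * max (Real.logb 2 (1/2 + p10/(2*p30 + σ))) 0)
    (hR30 : R30 = 1/2 * max (Real.logb 2 (1/2 + p30/σ)) 0) :
    R10 + R11 ≥ (C13 - C23 + C24 - C4) - 1/2 ∧ R10 ≥ (C24 - C4) - 1/2 ∧
    R30 + R31 ≥ (C23 - C24 + C4) - 1/2 ∧ R30 ≥ C4 - 1/2 := by
  subst hp10 hp30 hp11 hp31
  rw [show 2 * (a2 / 2) + 2 * (a4 / 2) + (a3 - a4) + σ = σ + (a2 + a3) by ring,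
    logb_two_one_add_div (by linarith) (by positivity),
    show σ + (a2 + a3) + (a1 - a2) = σ + (a1 + a3) by ring] at hR11
  rw [show 2 * (a2 / 2) + 2 * (a4 / 2) + σ = σ + (a2 + a4) by ring,
    logb_two_one_add_div (by linarith) (by positivity),
    show σ + (a2 + a4) + (a3 - a4) = σ + (a2 + a3) by ring] at hR31
  rw [show 2 * (a4 / 2) + σ = σ + a4 by ring,
    logb_two_half_add_div ha2.le (by positivity),
    show σ + a4 + a2 = σ + (a2 + a4) by ring] at hR10
  rw [logb_two_half_add_div ha4.le hσ] at hR30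
  rw [logb_two_one_add_div (by positivity) hσ] at hC4 hC13 hC23 hC24
  have h10 := le_max_left
    (Real.logb 2 (σ + (a2 + a4)) - Real.logb 2 (σ + a4) - 1) 0
  have h30 := le_max_left (Real.logb 2 (σ + a4) - Real.logb 2 σ - 1) 0
  refine ⟨?_, ?_, ?_, ?_⟩ <;> linarith
end

section
/- Suppose b₁ ≥ b₃ ≥ b₄ ≥ b₂ > 0 and P ≥ b₁. Then (1/2)·log((b₄ + b₂)/b₂ · (P + b₃)/(b₁ + b₃)) + 1/2 ≥ (1/2)·log((P + b₂)/b₂ · b₄/(P + b₄) · (P + b₁)/b₁); (1/2)·log((P + b₁)/(2b₁)) + 1/2 ≥ D₁; (1/2)·log((b₁ + b₄)/(2b₄)) + 1/2 ≥ D₄ − D₁; and (1/2)·log((b₁ + b₃)/(b₄ + b₃)) + 1/2 ≥ D₃ − D₁. -/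
theorem half_logb_two_le_add_half {x y : ℝ} (hy : 0 < y) (h : y ≤ 2 * x) :
    1/2 * Real.logb 2 y ≤ 1/2 * Real.logb 2 x + 1/2 := by
  have hx : 0 < x := by linarith
  have h1 : Real.logb 2 y ≤ Real.logb 2 (2 * x) :=
    Real.logb_le_logb_of_le (by norm_num) hy h
  rw [Real.logb_mul (by norm_num) hx.ne', Real.logb_self_eq_one (by norm_num)] at h1
  linarith

theorem half_logb_two_one_add_div_sub {P a b : ℝ} (hP : 0 < P) (ha : 0 < a) (hb : 0 < b) :
    1/2 * Real.logb 2 (1 + P/a) - 1/2 * Real.logb 2 (1 + P/b) =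
      1/2 * Real.logb 2 ((P + a)/(P + b) * (b/a)) := by
  rw [← mul_sub, ← Real.logb_div (by positivity) (by positivity)]
  congr 2
  field_simp
  ring


theorem stmt18 (b1 b2 b3 b4 P D1 D2 D3 D4 : ℝ)
    (hb2 : 0 < b2) (h24 : b2 ≤ b4) (h43 : b4 ≤ b3) (h31 : b3 ≤ b1)
    (hP0 : 0 < P) (hP : b1 ≤ P)
    (hD1 : D1 = 1/2 * Real.logb 2 (1 + P/b1))
    (hD2 : D2 = 1/2 * Real.logb 2 (1 + P/b2))
    (hD3 : D3 = 1/2 * Real.logb 2 (1 + P/b3))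
    (hD4 : D4 = 1/2 * Real.logb 2 (1 + P/b4)) :
    1/2 * Real.logb 2 ((b4 + b2)/b2 * ((P + b3)/(b1 + b3))) + 1/2 ≥
      1/2 * Real.logb 2 ((P + b2)/b2 * (b4/(P + b4)) * ((P + b1)/b1)) ∧
    1/2 * Real.logb 2 ((P + b1)/(2*b1)) + 1/2 ≥ D1 ∧
    1/2 * Real.logb 2 ((b1 + b4)/(2*b4)) + 1/2 ≥ D4 - D1 ∧
    1/2 * Real.logb 2 ((b1 + b3)/(b4 + b3)) + 1/2 ≥ D3 - D1 := by
  have hb4 : 0 < b4 := by linarith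
  have hb3 : 0 < b3 := by linarith
  have hb1 : 0 < b1 := by linarith
  subst hD1 hD2 hD3 hD4
  refine ⟨?_, ?_, ?_, ?_⟩
  · apply half_logb_two_le_add_half (by positivity)
    have h1 : (P + b2)/b2 * (b4/(P + b4)) ≤ (b4 + b2)/b2 := by
      rw [div_mul_div_comm, div_le_div_iff₀ (by positivity) (by positivity)]
      have : (P + b2) * b4 ≤ (b4 + b2) * (P + b4) := by nlinarith [mul_pos hb2 hP0]
      nlinarith
    have h2 : (P + b1)/b1 ≤ 2 * ((P + b3)/(b1 + b3)) := by
      rw [← mul_div_assoc, div_le_div_iff₀ (by positivity) (by positivity)]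
      nlinarith [mul_nonneg (sub_nonneg.2 hP) (sub_nonneg.2 h31)]
    calc _ ≤ (b4 + b2)/b2 * (2 * ((P + b3)/(b1 + b3))) := by gcongr
      _ = _ := by ring
  · apply half_logb_two_le_add_half (by positivity)
    apply le_of_eq
    field_simp
    ring
  · rw [half_logb_two_one_add_div_sub hP0 hb4 hb1]
    apply half_logb_two_le_add_half (by positivity)
    have h1 : (P + b4)/(P + b1) ≤ 1 := (div_le_one (by positivity)).2 (by linarith)
    calc _ ≤ 1 * (b1/b4) := by gcongr
      _ ≤ (b1 + b4)/b4 := by rw [one_mul]; gcongr; linarith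
      _ = _ := by field_simp
  · rw [half_logb_two_one_add_div_sub hP0 hb3 hb1]
    apply half_logb_two_le_add_half (by positivity)
    have h1 : (P + b3)/(P + b1) ≤ 1 := (div_le_one (by positivity)).2 (by linarith)
    calc _ ≤ 1 * (b1/b3) := by gcongr
      _ ≤ _ := by
        rw [one_mul, ← mul_div_assoc, div_le_div_iff₀ (by positivity) (by positivity)]
        nlinarith [mul_le_mul_of_nonneg_left h43 hb1.le, mul_pos hb3 hb3]
end
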